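/- arXiv:2007.07578 — 3 statements merged into one kernel-verified Lean document; each statement's English description precedes it below -/
import Mathlib

section
/- Let p ≥ 5 be a prime, ℓ ≥ 1, κ ≥ p, and let m be a divisor of p − 1 with m > 2. Then the normalizer of G(m, m, κ) in GL_κ(ℤ/p^ℓ) equals the subgroup generated by G(m, 1, κ) together with all scalar matrices u·I for u ∈ (ℤ/p^ℓ)^×. -/
open Matrix

/-- For `k ∣ m` and a commutative ring `R`, `G(m, k, κ) ≤ GL_κ(R)` is the subgroup generated
by the permutation matrices together with the diagonal matrices `diag(u₁, …, u_κ)` with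
`uᵢ^m = 1` for all `i` and `(u₁⋯u_κ)^(m/k) = 1`. -/
def Gmk (m k κ : ℕ) (R : Type) [CommRing R] : Subgroup (GL (Fin κ) R) :=
  Subgroup.closure
    ({M : GL (Fin κ) R | ∃ σ : Equiv.Perm (Fin κ),
        (M : Matrix (Fin κ) (Fin κ) R) = Matrix.of fun i j => if σ j = i then (1 : R) else 0} ∪
     {M : GL (Fin κ) R | ∃ u : Fin κ → R, (∀ i, u i ^ m = 1) ∧ (∏ i, u i) ^ (m / k) = 1 ∧
        (M : Matrix (Fin κ) (Fin κ) R) = Matrix.diagonal u})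

/-- The monomial matrix sending the basis vector `eⱼ` to `uⱼ • e_{σ j}`. -/
def monomialMatrix {n R : Type*} [DecidableEq n] [Zero R] (σ : Equiv.Perm n) (u : n → R) :
    Matrix n n R :=
  Matrix.of fun i j => if σ j = i then u j else 0

section MonomialMatrix

variable {n R : Type*} [DecidableEq n]

theorem monomialMatrix_apply [Zero R] (σ : Equiv.Perm n) (u : n → R) (i j : n) :
    monomialMatrix σ u i j = if σ j = i then u j else 0 := rfl

theorem monomialMatrix_mul [Fintype n] [CommRing R] (σ τ : Equiv.Perm n) (u v : n → R) :
    monomialMatrix σ u * monomialMatrix τ v =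
      monomialMatrix (σ * τ) fun j => u (τ j) * v j := by
  ext i j
  simp only [Matrix.mul_apply, monomialMatrix_apply, Equiv.Perm.mul_apply, mul_ite, mul_zero,
    Finset.sum_ite_eq, Finset.mem_univ, if_true, ite_mul, zero_mul]
  congr

theorem monomialMatrix_refl [Zero R] (u : n → R) :
    monomialMatrix (1 : Equiv.Perm n) u = Matrix.diagonal u := by
  ext i j
  by_cases h : i = j
  · simp [monomialMatrix_apply, h]
  · simp [monomialMatrix_apply, h, Ne.symm h]

theorem monomialMatrix_one [Zero R] [One R] :
    monomialMatrix (1 : Equiv.Perm n) (fun _ => (1 : R)) = 1 := by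
  rw [monomialMatrix_refl, Matrix.diagonal_one]

theorem eq_of_monomialMatrix_eq [Zero R] {σ τ : Equiv.Perm n} {u v : n → R}
    (h : monomialMatrix σ u = monomialMatrix τ v) {j : n} (hj : u j ≠ 0) : u j = v j := by
  have := congrFun (congrFun h (σ j)) j
  simp only [monomialMatrix_apply, if_true] at this
  split_ifs at this with h1
  · exact this
  · exact absurd this hj

/-- The monomial reflection exchanging `eᵢ` and `w • eⱼ` is the identity plus a rank one matrix. -/
theorem monomialMatrix_swap [CommRing R] {i j : n} (hij : i ≠ j) {w w' : R} (hw : w' * w = 1) :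
    monomialMatrix (Equiv.swap i j)
        (Function.update (Function.update (fun _ => 1) i w) j w') =
      1 + Matrix.vecMulVec (Pi.single i 1 - w • Pi.single j 1)
        (w' • Pi.single j 1 - Pi.single i 1) := by
  ext r s
  simp only [monomialMatrix_apply, Matrix.add_apply, Matrix.vecMulVec_apply, Matrix.one_apply,
    Pi.sub_apply, Pi.smul_apply, Pi.single_apply, Function.update_apply, smul_eq_mul,
    Equiv.swap_apply_def]
  have hw2 : w * w' = 1 := by rw [mul_comm, hw]
  by_cases hsi : s = i
  · subst hsi
    by_cases hrs : r = s
    · subst hrs; simp [hij, hij.symm]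
    · by_cases hrj : r = j
      · subst hrj; simp [hij, hrs]
      · simp [hij, hrs, hrj, Ne.symm hrj]
  · by_cases hsj : s = j
    · subst hsj
      by_cases hri : r = i
      · subst hri; simp [hij, hij.symm]
      · by_cases hrs : r = s
        · subst hrs; simp [hij.symm, hij, hw2]
        · simp [hri, hrs, hsi, Ne.symm hri]
    · simp [hsi, hsj, eq_comm]

end MonomialMatrix

section Gmk

variable {m k κ : ℕ} {R : Type} [CommRing R]

theorem exists_mem_Gmk (hm : m ≠ 0) (σ : Equiv.Perm (Fin κ)) {u : Fin κ → R}
    (hu : ∀ i, u i ^ m = 1) (hu' : (∏ i, u i) ^ (m / k) = 1) :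
    ∃ M ∈ Gmk m k κ R, (M : Matrix (Fin κ) (Fin κ) R) = monomialMatrix σ u := by
  have hu1 : ∀ i, u i * u i ^ (m - 1) = 1 := fun i => by
    rw [mul_pow_sub_one hm, hu]
  let P : GL (Fin κ) R :=
    ⟨monomialMatrix σ fun _ => 1, monomialMatrix σ⁻¹ fun _ => 1,
      by simp [monomialMatrix_mul, monomialMatrix_one],
      by simp [monomialMatrix_mul, monomialMatrix_one]⟩
  let D : GL (Fin κ) R :=
    ⟨Matrix.diagonal u, Matrix.diagonal fun i => u i ^ (m - 1),
      by simp [Matrix.diagonal_mul_diagonal, hu1],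
      by simp [Matrix.diagonal_mul_diagonal, mul_comm _ (u _), hu1]⟩
  refine ⟨P * D, mul_mem (Subgroup.subset_closure (Or.inl ⟨σ, rfl⟩))
    (Subgroup.subset_closure (Or.inr ⟨u, hu, hu', rfl⟩)), ?_⟩
  change monomialMatrix σ (fun _ => 1) * Matrix.diagonal u = _
  rw [← monomialMatrix_refl, monomialMatrix_mul]
  simp

theorem exists_eq_monomialMatrix (hm : m ≠ 0) {M : GL (Fin κ) R} (hM : M ∈ Gmk m k κ R) :
    ∃ (σ : Equiv.Perm (Fin κ)) (u : Fin κ → R), (∀ i, u i ^ m = 1) ∧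
      (∏ i, u i) ^ (m / k) = 1 ∧ (M : Matrix (Fin κ) (Fin κ) R) = monomialMatrix σ u := by
  induction hM using Subgroup.closure_induction with
  | mem M h =>
    rcases h with ⟨σ, h⟩ | ⟨u, hu, hu', h⟩
    · exact ⟨σ, fun _ => 1, by simp, by simp, h⟩
    · exact ⟨1, u, hu, hu', by rw [h, monomialMatrix_refl]⟩
  | one => exact ⟨1, fun _ => 1, by simp, by simp, by simp [monomialMatrix_one]⟩
  | mul M N _ _ hM hN =>
    obtain ⟨σ, u, hu, hu', hM⟩ := hM
    obtain ⟨τ, v, hv, hv', hN⟩ := hN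
    refine ⟨σ * τ, fun j => u (τ j) * v j, fun i => by rw [mul_pow, hu, hv, one_mul], ?_, ?_⟩
    · rw [Finset.prod_mul_distrib, Equiv.prod_comp τ u, mul_pow, hu', hv', one_mul]
    · rw [Units.val_mul, hM, hN, monomialMatrix_mul]
  | inv M _ hM =>
    obtain ⟨σ, u, hu, hu', hM⟩ := hM
    refine ⟨σ⁻¹, fun j => u (σ⁻¹ j) ^ (m - 1), fun i => ?_, ?_, ?_⟩
    · rw [← pow_mul, mul_comm, pow_mul, hu, one_pow]
    · rw [Finset.prod_pow, Equiv.prod_comp σ⁻¹ u, ← pow_mul, mul_comm, pow_mul, hu', one_pow]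
    · refine Units.inv_eq_of_mul_eq_one_right ?_
      rw [hM, monomialMatrix_mul]
      simp only [mul_inv_cancel, mul_pow_sub_one hm, hu, monomialMatrix_one]

theorem conj_mem_Gmk (hm : m ≠ 0) {g h : GL (Fin κ) R} (hg : g ∈ Gmk m 1 κ R)
    (hh : h ∈ Gmk m k κ R) : g * h * g⁻¹ ∈ Gmk m k κ R := by
  obtain ⟨σ, u, hu, -, hg⟩ := exists_eq_monomialMatrix hm hg
  obtain ⟨τ, v, hv, hv', hh⟩ := exists_eq_monomialMatrix hm hh
  have hu1 : ∀ i, u i ^ (m - 1) * u i = 1 := fun i => by rw [pow_sub_one_mul hm, hu]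
  obtain ⟨N, hN, hNe⟩ := exists_mem_Gmk (k := k) (R := R) hm (σ * τ * σ⁻¹)
    (u := fun j => u (τ (σ⁻¹ j)) * v (σ⁻¹ j) * u (σ⁻¹ j) ^ (m - 1))
    (fun i => by
      rw [mul_pow, mul_pow, hu, hv, ← pow_mul, mul_comm (m - 1), pow_mul, hu]; simp)
    (by
      rw [Equiv.prod_comp σ⁻¹ fun j => u (τ j) * v j * u j ^ (m - 1), Finset.prod_mul_distrib,
        Finset.prod_mul_distrib, Equiv.prod_comp τ u, mul_right_comm, ← Finset.prod_mul_distrib]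
      simp only [mul_comm (u _), hu1, Finset.prod_const_one, one_mul, hv'])
  have : N * g = g * h := by
    ext1
    rw [Units.val_mul, Units.val_mul, hNe, hg, hh, monomialMatrix_mul, monomialMatrix_mul]
    simp [mul_assoc, hu1]
  rwa [← this, mul_inv_cancel_right]

theorem Gmk_one_le_normalizer (hm : m ≠ 0) :
    Gmk m 1 κ R ≤ Subgroup.normalizer (Gmk m k κ R) := by
  intro g hg
  rw [Subgroup.mem_normalizer_iff]
  refine fun h => ⟨conj_mem_Gmk hm hg, fun hh => ?_⟩
  simpa [mul_assoc] using conj_mem_Gmk hm (inv_mem hg) hh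

theorem ncard_root_support [IsLocalRing R] (hm : m ≠ 0) {g : GL (Fin κ) R}
    (hg : g ∈ Subgroup.normalizer (Gmk m m κ R)) {i j : Fin κ} (hij : i ≠ j) {w : R}
    (hw : w ^ m = 1) [DecidableEq R] :
    (Finset.univ.filter fun r => g r i - w * g r j ≠ 0).card = 2 := by
  have hmm : m / m = 1 := Nat.div_self (Nat.pos_of_ne_zero hm)
  have hw1 : w ^ (m - 1) * w = 1 := by rw [pow_sub_one_mul hm, hw]
  set α : Fin κ → R := Pi.single i 1 - w • Pi.single j 1 with hα
  set β : Fin κ → R := w ^ (m - 1) • Pi.single j 1 - Pi.single i 1 with hβ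
  obtain ⟨t, ht, hte⟩ := exists_mem_Gmk (k := m) (R := R) hm (Equiv.swap i j)
    (u := Function.update (Function.update (fun _ => 1) i w) j (w ^ (m - 1)))
    (fun r => by
      simp only [Function.update_apply]
      split_ifs
      · rw [← pow_mul, mul_comm, pow_mul, hw, one_pow]
      · exact hw
      · exact one_pow _)
    (by
      rw [Finset.prod_update_of_mem (Finset.mem_univ _), Finset.prod_update_of_mem (by simp [hij])]
      simp [hw1])
  rw [monomialMatrix_swap hij hw1, ← hα, ← hβ] at hte
  obtain ⟨σ, v, hv, hv', hM⟩ :=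
    exists_eq_monomialMatrix hm ((Subgroup.mem_normalizer_iff.1 hg t).1 ht)
  rw [hmm, pow_one] at hv'
  set x : Fin κ → R := (g : Matrix (Fin κ) (Fin κ) R) *ᵥ α with hx
  set y : Fin κ → R := β ᵥ* g⁻¹.val with hy
  have hginv : g.val * g⁻¹.val = 1 := g.mul_inv
  have hinvg : g⁻¹.val * g.val = 1 := g.inv_mul
  have hxy : monomialMatrix σ v = 1 + Matrix.vecMulVec x y := by
    rw [← hM, Units.val_mul, Units.val_mul, hte, mul_add, add_mul, mul_one, hginv,
      Matrix.mul_vecMulVec, Matrix.vecMulVec_mul]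
  have hxr : ∀ r, x r = g r i - w * g r j := fun r => by
    simp [hx, hα, Matrix.mulVec_sub, Matrix.mulVec_smul]
  have hx0 : x ≠ 0 := fun h => by
    have h1 : g⁻¹.val *ᵥ x = α := by
      rw [hx, Matrix.mulVec_mulVec, hinvg, Matrix.one_mulVec]
    have h2 := congrFun h1 i
    simp [h, hα, hij] at h2
  obtain ⟨q, hq⟩ : ∃ q, IsUnit (y q) := by
    have h1 : y ᵥ* (g : Matrix (Fin κ) (Fin κ) R) = β := by
      rw [hy, Matrix.vecMul_vecMul, hinvg, Matrix.vecMul_one]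
    have h2 : ∑ q, y q * g q i = -1 := by
      have := congrFun h1 i
      simpa [hβ, hij, Matrix.vecMul, dotProduct] using this
    obtain ⟨q, -, hq⟩ := IsLocalRing.exists_of_isUnit_sum (s := Finset.univ)
      (f := fun q => y q * g q i) (by rw [h2]; exact isUnit_one.neg)
    exact ⟨q, isUnit_of_mul_isUnit_left hq⟩
  have hent : ∀ r s, (if σ s = r then v s else 0) = (if r = s then 1 else 0) + x r * y s :=
    fun r s => by
      have := congrFun (congrFun hxy r) s
      simpa [monomialMatrix_apply, Matrix.one_apply, Matrix.vecMulVec_apply] using this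
  have hx_iff : ∀ r, x r ≠ 0 ↔ x r * y q ≠ 0 := fun r => by
    rw [Ne, Ne, hq.mul_left_eq_zero]
  have hv0 : ∀ r, v r ≠ 0 := fun r h => by simpa [h, hm] using hv r
  by_cases hσ : σ q = q
  · exfalso
    have hxq : ∀ r, r ≠ q → x r = 0 := fun r hr => by
      have := hent r q
      rw [hσ, if_neg hr.symm, if_neg hr, zero_add] at this
      by_contra h
      exact (hx_iff r).1 h this.symm
    have hvs : ∀ s, s ≠ q → v s = 1 := fun s hs => by
      have := hent s s
      rw [hxq s hs] at this
      by_cases h : σ s = s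
      · simpa [h] using this
      · simp [h] at this
    have hvq : v q = 1 := by
      rwa [Finset.prod_eq_single q (fun s _ hs => hvs s hs) (by simp)] at hv'
    have hq0 : x q = 0 := by
      have := hent q q
      by_contra h
      refine (hx_iff q).1 h ?_
      simpa [hσ, hvq] using this
    refine hx0 (funext fun r => ?_)
    by_cases h : r = q
    · rw [h, hq0]; rfl
    · exact hxq r h
  · have : (Finset.univ.filter fun r => g r i - w * g r j ≠ 0) = {q, σ q} := by
      ext r
      simp only [Finset.mem_filter, Finset.mem_univ, true_and, Finset.mem_insert,
        Finset.mem_singleton]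
      rw [← hxr, hx_iff]
      have h := hent r q
      by_cases h1 : r = q
      · subst h1
        rw [if_neg hσ, if_pos rfl] at h
        have h2 : x r * y r = -1 := by linear_combination -h
        simp [h2]
      · rw [if_neg h1, zero_add] at h
        rw [← h]
        by_cases h2 : σ q = r
        · simp [h2, hv0]
        · simp [h1, h2, Ne.symm h2]
    rw [this, Finset.card_pair (Ne.symm hσ)]

/-- If `a - b`, `a - z b` and `a - z² b` all have exactly two nonzero coordinates, and `a` has at
least two, then `a` has at most three and its support contains that of `b`. -/
theorem support_of_card_support_sub {ι S : Type*} [Fintype ι] [DecidableEq ι] [CommRing S]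
    [DecidableEq S] {z : S} (hz : IsUnit z) (hz1 : IsUnit (z - 1)) (hz2 : IsUnit (z ^ 2 - 1))
    {a b : ι → S} (h : ∀ e : ℕ, (Finset.univ.filter fun r => a r - z ^ e * b r ≠ 0).card = 2)
    (ha : 2 ≤ (Finset.univ.filter fun r => a r ≠ 0).card) :
    (Finset.univ.filter fun r => a r ≠ 0).card ≤ 3 ∧ ∀ r, b r ≠ 0 → a r ≠ 0 := by
  set A := Finset.univ.filter fun r => a r ≠ 0 with hA
  set N := Finset.univ.filter fun r => a r ≠ 0 ∨ b r ≠ 0 with hN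
  let W : ℕ → Finset ι := fun e => Finset.univ.filter fun r => a r - z ^ e * b r ≠ 0
  have hAN : A ⊆ N := fun r hr => by
    simp only [hA, hN, Finset.mem_filter, Finset.mem_univ, true_and] at hr ⊢
    exact Or.inl hr
  have hWN : ∀ e, W e ⊆ N := fun e r hr => by
    simp only [W, hN, Finset.mem_filter, Finset.mem_univ, true_and] at hr ⊢
    by_contra! hc
    exact hr (by simp [hc.1, hc.2])
  have hmem : ∀ e r, r ∈ N \ W e → a r = z ^ e * b r ∧ b r ≠ 0 := fun e r hr => by
    simp only [W, hN, Finset.mem_sdiff, Finset.mem_filter, Finset.mem_univ, true_and,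
      not_not, sub_eq_zero] at hr
    refine ⟨hr.2, fun hb => ?_⟩
    rcases hr.1 with h1 | h1
    · exact h1 (by rw [hr.2, hb, mul_zero])
    · exact h1 hb
  have hsub : ∀ e, N \ W e ⊆ A := fun e r hr => by
    obtain ⟨h1, h2⟩ := hmem e r hr
    simp only [hA, Finset.mem_filter, Finset.mem_univ, true_and]
    rw [h1]
    exact fun h3 => h2 ((hz.pow e).mul_right_eq_zero.1 h3)
  have hcard : ∀ e, (N \ W e).card = N.card - 2 := fun e => by
    rw [Finset.card_sdiff_of_subset (hWN e)]; exact congrArg _ (h e)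
  have hdisj : ∀ e d, IsUnit (z ^ d - 1) → Disjoint (N \ W e) (N \ W (e + d)) := fun e d hd => by
    rw [Finset.disjoint_left]
    intro r h1 h2
    obtain ⟨h3, h4⟩ := hmem e r h1
    obtain ⟨h5, -⟩ := hmem _ r h2
    refine h4 (((hz.pow e).mul hd).mul_right_eq_zero.1 ?_)
    rw [pow_add] at h5
    linear_combination h3 - h5
  have hz1' : IsUnit (z ^ 1 - 1) := by rwa [pow_one]
  have h3 : ((N \ W 0 ∪ N \ W 1) ∪ N \ W 2).card ≤ A.card :=
    Finset.card_le_card (Finset.union_subset (Finset.union_subset (hsub 0) (hsub 1)) (hsub 2))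
  rw [Finset.card_union_of_disjoint (Finset.disjoint_union_left.2
      ⟨hdisj 0 2 hz2, hdisj 1 1 hz1'⟩), Finset.card_union_of_disjoint (hdisj 0 1 hz1'),
    hcard, hcard, hcard] at h3
  have h4 := Finset.card_le_card hAN
  refine ⟨by omega, fun r hr => ?_⟩
  have hEq : A = N := Finset.eq_of_subset_of_card_le hAN (by omega)
  have : r ∈ A := by
    rw [hEq]
    simp only [hN, Finset.mem_filter, Finset.mem_univ, true_and]
    exact Or.inr hr
  simpa [hA] using this

theorem exists_eq_monomialMatrix_of_mem_normalizer [IsLocalRing R] (hm : m ≠ 0) (hκ : 4 ≤ κ)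
    {z : R} (hz : z ^ m = 1) (hz1 : IsUnit (z - 1)) (hz2 : IsUnit (z ^ 2 - 1))
    {g : GL (Fin κ) R} (hg : g ∈ Subgroup.normalizer (Gmk m m κ R)) :
    ∃ (π : Equiv.Perm (Fin κ)) (c : Fin κ → R), (∀ i, IsUnit (c i)) ∧
      (g : Matrix (Fin κ) (Fin κ) R) = monomialMatrix π c := by
  classical
  have hginv : g.val * g⁻¹.val = 1 := g.mul_inv
  have hinvg : g⁻¹.val * g.val = 1 := g.inv_mul
  have hzu : IsUnit z := IsUnit.of_pow_eq_one hz hm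
  have hle : ∀ i, (Finset.univ.filter fun r => g r i ≠ 0).card ≤ 1 := by
    intro i
    by_contra! hi
    have key : ∀ j, i ≠ j → _ := fun j hij =>
      support_of_card_support_sub (a := fun r => g r i) (b := fun r => g r j) hzu hz1 hz2
        (fun e => ncard_root_support hm hg hij
          (by rw [← pow_mul, mul_comm, pow_mul, hz, one_pow])) hi
    have : Nontrivial (Fin κ) := Fin.nontrivial_iff_two_le.2 (by omega)
    obtain ⟨j, hj⟩ := exists_ne i
    have h3 := (key j hj.symm).1
    obtain ⟨r, hr⟩ : ∃ r, r ∉ Finset.univ.filter fun r => g r i ≠ 0 := by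
      by_contra! hc
      rw [Finset.eq_univ_iff_forall.2 hc, Finset.card_univ, Fintype.card_fin] at h3
      omega
    have hri : g r i = 0 := by simpa using hr
    have hr0 : ∀ s, g r s = 0 := fun s => by
      by_cases hs : i = s
      · rw [← hs, hri]
      · by_contra hc
        exact (key s hs).2 r hc hri
    have := congrFun (congrFun hginv r) r
    simp [Matrix.mul_apply, hr0] at this
  have hcol : ∀ i, ∃ q, ∀ r, r ≠ q → g r i = 0 := by
    intro i
    have : Nonempty (Fin κ) := ⟨i⟩
    obtain ⟨q, hq⟩ := Finset.card_le_one_iff_subset_singleton.1 (hle i)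
    exact ⟨q, fun r hr => by
      by_contra hc
      exact hr (Finset.mem_singleton.1 (hq (by simpa using hc)))⟩
  choose π hπ using hcol
  have hsum : ∀ i j, g⁻¹.val i (π j) * g (π j) j =
      if i = j then 1 else 0 := fun i j => by
    have := congrFun (congrFun hinvg i) j
    rwa [Matrix.mul_apply, Finset.sum_eq_single (π j) (fun r _ hr => by rw [hπ j r hr, mul_zero])
      (by simp), Matrix.one_apply] at this
  have hunit : ∀ i, IsUnit (g (π i) i) := fun i =>
    IsUnit.of_mul_eq_one_right _ (by simpa using hsum i i)
  have hinj : Function.Injective π := fun i j hij => by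
    by_contra hne
    have h1 := hsum i j
    rw [if_neg hne, (hunit j).mul_left_eq_zero, ← hij] at h1
    have h2 := hsum i i
    rw [h1] at h2
    simp at h2
  refine ⟨Equiv.ofBijective π (Finite.injective_iff_bijective.1 hinj), fun i => g (π i) i,
    hunit, ?_⟩
  ext r s
  rw [monomialMatrix_apply, Equiv.ofBijective_apply]
  split_ifs with h
  · rw [h]
  · exact hπ s r (Ne.symm h)

theorem normalizer_Gmk [IsLocalRing R] (hm : m ≠ 0) (hκ : 4 ≤ κ)
    {z : R} (hz : z ^ m = 1) (hz1 : IsUnit (z - 1)) (hz2 : IsUnit (z ^ 2 - 1)) :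
    Subgroup.normalizer (Gmk m m κ R) =
      Subgroup.closure
        ((Gmk m 1 κ R : Set (GL (Fin κ) R)) ∪
          {g : GL (Fin κ) R | ∃ u : Rˣ,
            (g : Matrix (Fin κ) (Fin κ) R) = Matrix.diagonal fun _ => (u : R)}) := by
  refine le_antisymm (fun g hg => ?_) ?_
  · obtain ⟨π, c, hc, hgc⟩ := exists_eq_monomialMatrix_of_mem_normalizer hm hκ hz hz1 hz2 hg
    have hratio : ∀ i j, ∃ v : R, v ^ m = 1 ∧ c j = v * c i := by
      intro i j
      obtain ⟨t, ht, hte⟩ := exists_mem_Gmk (k := m) (R := R) hm (Equiv.swap i j)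
        (u := fun _ => 1) (by simp) (by simp)
      obtain ⟨σ, v, hv, -, hM⟩ :=
        exists_eq_monomialMatrix hm ((Subgroup.mem_normalizer_iff.1 hg t).1 ht)
      have h1 : monomialMatrix π c * monomialMatrix (Equiv.swap i j) (fun _ => 1) =
          monomialMatrix σ v * monomialMatrix π c := by
        rw [← hM, ← hgc, ← hte, ← Units.val_mul, ← Units.val_mul, inv_mul_cancel_right]
      rw [monomialMatrix_mul, monomialMatrix_mul] at h1
      have h2 := eq_of_monomialMatrix_eq h1 (j := i) (by simpa using (hc j).ne_zero)
      exact ⟨v (π i), hv _, by simpa using h2⟩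
    let i₀ : Fin κ := ⟨0, by omega⟩
    choose v hv hcv using hratio i₀
    obtain ⟨M, hM, hMe⟩ := exists_mem_Gmk (k := 1) (R := R) hm π hv
      (by rw [Nat.div_one, ← Finset.prod_pow]; simp [hv])
    let s : GL (Fin κ) R := ⟨Matrix.diagonal fun _ => ((hc i₀).unit : R),
      Matrix.diagonal fun _ => (((hc i₀).unit⁻¹ : Rˣ) : R),
      by simp [Matrix.diagonal_mul_diagonal], by simp [Matrix.diagonal_mul_diagonal]⟩
    have hgs : g = M * s := by
      ext1
      rw [Units.val_mul, hMe, hgc]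
      change _ = _ * Matrix.diagonal _
      rw [← monomialMatrix_refl, monomialMatrix_mul, mul_one]
      exact congrArg _ (funext hcv)
    rw [hgs]
    exact mul_mem (Subgroup.subset_closure (Or.inl hM))
      (Subgroup.subset_closure (Or.inr ⟨(hc i₀).unit, rfl⟩))
  · rw [Subgroup.closure_le, Set.union_subset_iff]
    refine ⟨Gmk_one_le_normalizer hm, ?_⟩
    rintro g ⟨u, hu⟩
    rw [SetLike.mem_coe, Subgroup.mem_normalizer_iff]
    intro h
    have : g * h = h * g := by
      ext1
      rw [Units.val_mul, Units.val_mul, hu]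
      ext r s
      rw [Matrix.diagonal_mul, Matrix.mul_diagonal, mul_comm]
    rw [this, mul_inv_cancel_right]

end Gmk

section ZModPrimePow

variable {p ℓ : ℕ}

theorem isLocalHom_castHom_prime_pow (hp : p.Prime) (h : p ∣ p ^ ℓ) :
    IsLocalHom (ZMod.castHom h (ZMod p)) where
  map_nonunit a ha := by
    have : NeZero (p ^ ℓ) := ⟨pow_ne_zero _ hp.ne_zero⟩
    obtain ⟨n, rfl⟩ := ZMod.natCast_zmod_surjective a
    rw [map_natCast, ZMod.isUnit_iff_coprime] at ha
    exact (ZMod.isUnit_iff_coprime n _).2 (ha.pow_right ℓ)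

theorem isLocalRing_zmod_prime_pow (hp : p.Prime) (hℓ : 1 ≤ ℓ) : IsLocalRing (ZMod (p ^ ℓ)) := by
  have := Fact.mk hp
  have := isLocalHom_castHom_prime_pow hp (dvd_pow_self p (by omega : ℓ ≠ 0))
  exact RingHom.domain_isLocalRing (ZMod.castHom (dvd_pow_self p (by omega : ℓ ≠ 0)) (ZMod p))

theorem exists_root_of_unity_zmod_prime_pow {m : ℕ} (hp : p.Prime) (hℓ : 1 ≤ ℓ) (hm : m ∣ p - 1) :
    ∃ z : ZMod (p ^ ℓ), z ^ m = 1 ∧ ∀ d, ¬ m ∣ d → IsUnit (z ^ d - 1) := by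
  have := Fact.mk hp
  have : NeZero (p ^ ℓ) := ⟨pow_ne_zero _ hp.ne_zero⟩
  have hdvd : p ∣ p ^ ℓ := dvd_pow_self p (by omega : ℓ ≠ 0)
  have := isLocalHom_castHom_prime_pow hp hdvd
  have hp1 : p - 1 ≠ 0 := by have := hp.two_le; omega
  obtain ⟨x, hx⟩ : ∃ x : (ZMod p)ˣ, orderOf x = m := by
    obtain ⟨g, hg⟩ := IsCyclic.exists_ofOrder_eq_natCard (α := (ZMod p)ˣ)
    rw [Nat.card_eq_fintype_card, ZMod.card_units] at hg
    obtain ⟨d, hd⟩ := hm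
    refine ⟨g ^ d, ?_⟩
    have hd0 : d ≠ 0 := fun h => hp1 (by rw [hd, h, mul_zero])
    rw [orderOf_pow_of_dvd hd0 (by rw [hg, hd]; exact dvd_mul_left _ _), hg, hd,
      Nat.mul_div_cancel _ (Nat.pos_of_ne_zero hd0)]
  obtain ⟨n, hn⟩ := ZMod.natCast_zmod_surjective (x : ZMod p)
  have hnp : ((n : ℤ) : ZMod p) = x := by rw [← hn]; simp
  refine ⟨((n : ℤ) : ZMod (p ^ ℓ)) ^ p ^ (ℓ - 1), ?_, fun d hd => ?_⟩
  · have h1 : (p : ℤ) ∣ (n : ℤ) ^ m - 1 := by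
      rw [← ZMod.intCast_zmod_eq_zero_iff_dvd]
      rw [Int.cast_sub, Int.cast_pow, hnp, Int.cast_one, ← Units.val_pow_eq_pow_val, ← hx,
        pow_orderOf_eq_one, Units.val_one, sub_self]
    have h2 := dvd_sub_pow_of_dvd_sub h1 (ℓ - 1)
    rw [one_pow, Nat.sub_add_cancel hℓ] at h2
    have h3 := (ZMod.intCast_zmod_eq_zero_iff_dvd _ (p ^ ℓ)).2 (by exact_mod_cast h2)
    push_cast at h3
    push_cast
    rw [← pow_mul, mul_comm, pow_mul]
    exact sub_eq_zero.1 h3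
  · refine isUnit_of_map_unit (ZMod.castHom hdvd (ZMod p)) _ ?_
    rw [map_sub, map_pow, map_pow, map_intCast, hnp, map_one, ZMod.pow_card_pow, isUnit_iff_ne_zero,
      sub_ne_zero, ← Units.val_pow_eq_pow_val, Ne, Units.val_eq_one]
    exact fun h => hd (hx ▸ orderOf_dvd_of_pow_eq_one h)

end ZModPrimePow

/-- For a prime `p ≥ 5`, `ℓ ≥ 1`, `κ ≥ p`, and `2 < m ∣ p - 1`, the
normalizer of `G(m, m, κ)` in `GL_κ(ℤ/p^ℓ)` is generated by `G(m, 1, κ)` together with the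
scalar matrices `u·I`, `u ∈ (ℤ/p^ℓ)ˣ`. -/
theorem stmt15 (p ℓ κ m : ℕ) (hp : p.Prime) (hp5 : 5 ≤ p) (hℓ : 1 ≤ ℓ) (hκ : p ≤ κ)
    (hm : m ∣ p - 1) (hm2 : 2 < m) :
    Subgroup.normalizer (Gmk m m κ (ZMod (p ^ ℓ))) =
      Subgroup.closure
        ((Gmk m 1 κ (ZMod (p ^ ℓ)) : Set (GL (Fin κ) (ZMod (p ^ ℓ)))) ∪
          {g : GL (Fin κ) (ZMod (p ^ ℓ)) | ∃ u : (ZMod (p ^ ℓ))ˣ,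
            (g : Matrix (Fin κ) (Fin κ) (ZMod (p ^ ℓ))) =
              Matrix.diagonal fun _ => (u : ZMod (p ^ ℓ))}) := by
  have := isLocalRing_zmod_prime_pow hp hℓ
  obtain ⟨z, hz, hzu⟩ := exists_root_of_unity_zmod_prime_pow hp hℓ hm
  refine normalizer_Gmk (by omega) (by omega) hz ?_ (hzu 2 fun h => ?_)
  · simpa using hzu 1 fun h => by have := Nat.le_of_dvd one_pos h; omega
  · have := Nat.le_of_dvd two_pos h; omega
end

section
/- Let W be the Coxeter group of type F₄. Then the subgroup O of W generated by all elements whose order is a power of 3 is a normal subgroup of index 4, and the quotient W/O is isomorphic to (ℤ/2) × (ℤ/2). -/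
/-- The two independent sign characters of the Coxeter group of type `F₄`, on the generators. -/
def f₄Sign : Fin 4 → Multiplicative (ZMod 2) × Multiplicative (ZMod 2) :=
  ![(.ofAdd 1, 1), (.ofAdd 1, 1), (1, .ofAdd 1), (1, .ofAdd 1)]

theorem isLiftable_f₄Sign : CoxeterMatrix.F₄.IsLiftable f₄Sign := by
  unfold CoxeterMatrix.IsLiftable
  decide

/-- The subgroup generated by the elements whose order is a power of `p` is normal. -/
theorem normal_closure_orderOf_eq_pow (G : Type*) [Group G] (p : ℕ) :
    (Subgroup.closure {w : G | ∃ k : ℕ, orderOf w = p ^ k}).Normal := by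
  refine ⟨fun x hx g => ?_⟩
  suffices h : Subgroup.closure {w : G | ∃ k : ℕ, orderOf w = p ^ k} ≤
      (Subgroup.closure {w : G | ∃ k : ℕ, orderOf w = p ^ k}).comap (MulAut.conj g).toMonoidHom from
    h hx
  rw [Subgroup.closure_le]
  rintro w ⟨k, hk⟩
  exact Subgroup.subset_closure ⟨k, ((MulAut.conj g).orderOf_eq w).trans hk⟩

/-- A homomorphism to a group of exponent two kills all elements of `3`-power order. -/
theorem closure_orderOf_eq_three_pow_le_ker {G H : Type*} [Group G] [Group H]
    (hH : ∀ h : H, h ^ 2 = 1) (φ : G →* H) :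
    Subgroup.closure {w : G | ∃ k : ℕ, orderOf w = 3 ^ k} ≤ φ.ker := by
  rw [Subgroup.closure_le]
  rintro w ⟨k, hk⟩
  have h3 : orderOf (φ w) ∣ 3 ^ k := hk ▸ orderOf_map_dvd φ w
  have h2 : orderOf (φ w) ∣ 2 := orderOf_dvd_of_pow_eq_one (hH _)
  exact orderOf_eq_one_iff.mp
    (Nat.eq_one_of_dvd_coprimes (Nat.Coprime.pow_left k (by norm_num)) h3 h2)

theorem mem_closure_of_pow_three_eq_one {G : Type*} [Group G] {w : G} (hw : w ^ 3 = 1) :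
    w ∈ Subgroup.closure {w : G | ∃ k : ℕ, orderOf w = 3 ^ k} := by
  obtain ⟨k, -, hk⟩ := (Nat.dvd_prime_pow Nat.prime_three).mp
    ((pow_one 3).symm ▸ orderOf_dvd_of_pow_eq_one hw : orderOf w ∣ 3 ^ 1)
  exact Subgroup.subset_closure ⟨k, hk⟩

/-- The kernel of the sign homomorphism lies in any normal subgroup containing the products
of the two pairs of generators joined by simple edges. -/
theorem ker_lift_f₄Sign_le (O : Subgroup CoxeterMatrix.F₄.Group) [O.Normal]
    (h01 : CoxeterMatrix.F₄.simple 0 * CoxeterMatrix.F₄.simple 1 ∈ O)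
    (h23 : CoxeterMatrix.F₄.simple 2 * CoxeterMatrix.F₄.simple 3 ∈ O) :
    (CoxeterMatrix.F₄.toCoxeterSystem.lift ⟨f₄Sign, isLiftable_f₄Sign⟩).ker ≤ O := by
  set cs := CoxeterMatrix.F₄.toCoxeterSystem
  set φ := cs.lift ⟨f₄Sign, isLiftable_f₄Sign⟩
  let q := QuotientGroup.mk' O
  have hφ (i) : φ (cs.simple i) = f₄Sign i := cs.lift_apply_simple isLiftable_f₄Sign i
  have q_eq {i j : Fin 4} (h : cs.simple i * cs.simple j ∈ O) :
      q (cs.simple j) = q (cs.simple i) := by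
    refine (QuotientGroup.eq.mpr ?_).symm
    rwa [cs.inv_simple]
  have q10 : q (cs.simple 1) = q (cs.simple 0) := q_eq h01
  have q32 : q (cs.simple 3) = q (cs.simple 2) := q_eq h23
  have hcomm : Commute (q (cs.simple 0)) (q (cs.simple 2)) := by
    have h : (cs.simple 0 * cs.simple 2) ^ 2 = 1 := cs.simple_mul_simple_pow 0 2
    refine Commute.map (f := q) (show cs.simple 0 * cs.simple 2 = _ from ?_)
    rw [pow_two, mul_eq_one_iff_eq_inv, mul_inv_rev, cs.inv_simple, cs.inv_simple] at h
    exact h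
  have key (w) : ∃ m n : ℕ, q w = q (cs.simple 0) ^ m * q (cs.simple 2) ^ n ∧
      φ w = (.ofAdd (m : ZMod 2), .ofAdd (n : ZMod 2)) := by
    induction w using cs.simple_induction with
    | simple i =>
      fin_cases i
      · exact ⟨1, 0, by simp, by rw [hφ]; rfl⟩
      · exact ⟨1, 0, by simpa using q10, by rw [hφ]; rfl⟩
      · exact ⟨0, 1, by simp, by rw [hφ]; rfl⟩
      · exact ⟨0, 1, by simpa using q32, by rw [hφ]; rfl⟩
    | one => exact ⟨0, 0, by simp, by simp [Prod.ext_iff]⟩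
    | mul w w' hw hw' =>
      obtain ⟨m, n, h, e⟩ := hw
      obtain ⟨m', n', h', e'⟩ := hw'
      refine ⟨m + m', n + n', ?_, ?_⟩
      · rw [map_mul, h, h', pow_add, pow_add]
        exact (hcomm.pow_pow m' n).symm.mul_mul_mul_comm _ _
      · rw [map_mul, e, e']
        simp [ofAdd_add]
  intro w hw
  obtain ⟨m, n, h, e⟩ := key w
  rw [MonoidHom.mem_ker.mp hw, Prod.ext_iff] at e
  have q_pow (i) {k : ℕ} (hk : (k : ZMod 2) = 0) : q (cs.simple i) ^ k = 1 := by
    obtain ⟨l, rfl⟩ := (ZMod.natCast_eq_zero_iff k 2).mp hk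
    rw [pow_mul, ← map_pow, cs.simple_sq, map_one, one_pow]
  rw [q_pow 0 (ofAdd_eq_one.mp e.1.symm), q_pow 2 (ofAdd_eq_one.mp e.2.symm), one_mul] at h
  exact (QuotientGroup.eq_one_iff w).mp h

theorem surjective_lift_f₄Sign :
    Function.Surjective
      (CoxeterMatrix.F₄.toCoxeterSystem.lift ⟨f₄Sign, isLiftable_f₄Sign⟩) := by
  have hφ := CoxeterSystem.lift_apply_simple CoxeterMatrix.F₄.toCoxeterSystem isLiftable_f₄Sign
  have hgen : ∀ x : Multiplicative (ZMod 2) × Multiplicative (ZMod 2),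
      ∃ m n : Fin 2, f₄Sign 0 ^ (m : ℕ) * f₄Sign 2 ^ (n : ℕ) = x := by decide
  intro x
  obtain ⟨m, n, rfl⟩ := hgen x
  exact ⟨CoxeterMatrix.F₄.toCoxeterSystem.simple 0 ^ (m : ℕ) *
    CoxeterMatrix.F₄.toCoxeterSystem.simple 2 ^ (n : ℕ), by rw [map_mul, map_pow, map_pow, hφ, hφ]⟩

/-- Let `W` be the Coxeter group of type `F₄`, and let `O ≤ W` be the
subgroup generated by all elements of `3`-power order. Then `O` is normal of index `4` in
`W`, and `W/O ≅ (ℤ/2) × (ℤ/2)`; the quotient is witnessed by a surjective homomorphism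
`W → (ℤ/2) × (ℤ/2)` with kernel `O`. -/
theorem stmt16
    (O : Subgroup CoxeterMatrix.F₄.Group)
    (hO : O = Subgroup.closure {w : CoxeterMatrix.F₄.Group | ∃ k : ℕ, orderOf w = 3 ^ k}) :
    O.Normal ∧ O.index = 4 ∧
      ∃ φ : CoxeterMatrix.F₄.Group →* Multiplicative (ZMod 2) × Multiplicative (ZMod 2),
        Function.Surjective φ ∧ φ.ker = O := by
  subst hO
  have hnormal := normal_closure_orderOf_eq_pow CoxeterMatrix.F₄.Group 3
  have hker : (CoxeterMatrix.F₄.toCoxeterSystem.lift ⟨f₄Sign, isLiftable_f₄Sign⟩).ker =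
      Subgroup.closure {w : CoxeterMatrix.F₄.Group | ∃ k : ℕ, orderOf w = 3 ^ k} :=
    le_antisymm
      (ker_lift_f₄Sign_le _
        (mem_closure_of_pow_three_eq_one
          (CoxeterMatrix.F₄.toCoxeterSystem.simple_mul_simple_pow 0 1))
        (mem_closure_of_pow_three_eq_one
          (CoxeterMatrix.F₄.toCoxeterSystem.simple_mul_simple_pow 2 3)))
      (closure_orderOf_eq_three_pow_le_ker (by decide) _)
  refine ⟨hnormal, ?_, _, surjective_lift_f₄Sign, hker⟩
  rw [← hker, Subgroup.index_ker, MonoidHom.range_eq_top.mpr surjective_lift_f₄Sign,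
    Subgroup.card_top]
  simp
end

section
/- For each n ∈ {6, 7, 8}, let W be the Coxeter group of type Eₙ, and let p be an odd prime dividing the order of W. Then the subgroup of W generated by all elements whose order is a power of p has index 2 in W. -/
namespace CoxeterMatrix

section Weights

variable {B : Type*}

/-- A Coxeter matrix is simply laced if its entries are at most `3` and nonzero. -/
def IsSimplyLaced (M : CoxeterMatrix B) : Prop :=
  ∀ i j, M i j = 1 ∨ M i j = 2 ∨ M i j = 3

/-- The entries of the Cartan matrix attached to a simply laced Coxeter matrix. -/
def cartan (M : CoxeterMatrix B) (i j : B) : ℤ :=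
  if M i j = 1 then 2 else if M i j = 3 then -1 else 0

/-- The simple reflection on weights, written in the basis of fundamental weights. -/
def reflect (M : CoxeterMatrix B) (i : B) (α : B → ℤ) : B → ℤ :=
  fun j ↦ α j - α i * M.cartan i j

variable (M : CoxeterMatrix B)

theorem eq_of_apply_eq_one {i j : B} (h : M i j = 1) : i = j :=
  by_contra fun hij ↦ M.off_diagonal i j hij h

theorem cartan_self (i : B) : M.cartan i i = 2 := by simp [cartan]

theorem cartan_comm (i j : B) : M.cartan i j = M.cartan j i := by
  simp [cartan, M.symmetric i j]

variable {M}

theorem cartan_eq_zero {i j : B} (h : M i j = 2) : M.cartan i j = 0 := by simp [cartan, h]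

theorem cartan_eq_neg_one {i j : B} (h : M i j = 3) : M.cartan i j = -1 := by simp [cartan, h]

theorem reflect_reflect (i : B) (α : B → ℤ) : M.reflect i (M.reflect i α) = α := by
  funext j
  simp only [reflect, cartan_self]
  ring

theorem reflect_comm {i j : B} (h : M i j = 2) (α : B → ℤ) :
    M.reflect i (M.reflect j α) = M.reflect j (M.reflect i α) := by
  funext k
  simp only [reflect, M.cartan_comm j i, cartan_eq_zero h]
  ring

theorem reflect_braid {i j : B} (h : M i j = 3) (α : B → ℤ) :
    M.reflect i (M.reflect j (M.reflect i α)) = M.reflect j (M.reflect i (M.reflect j α)) := by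
  funext k
  simp only [reflect, M.cartan_comm j i, cartan_eq_neg_one h, cartan_self]
  ring

variable {X : Type*}

/-- `σ` satisfies the commutation and braid relations between the simple reflections of a simply
laced Coxeter group. -/
structure IsSimpleAction (M : CoxeterMatrix B) (σ : B → X → X) : Prop where
  comm : ∀ i j x, M i j = 2 → σ i (σ j x) = σ j (σ i x)
  braid : ∀ i j x, M i j = 3 → σ i (σ j (σ i x)) = σ j (σ i (σ j x))

/-- `M.IsDescent σ x₀ ω k x α` says that some sequence of `k` simple reflections, each of them
lowering the current weight, takes `(x₀, ω)` to `(x, α)`. -/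
inductive IsDescent (M : CoxeterMatrix B) (σ : B → X → X) (x₀ : X) (ω : B → ℤ) :
    ℕ → X → (B → ℤ) → Prop
  | refl : IsDescent M σ x₀ ω 0 x₀ ω
  | step {k : ℕ} {x : X} {α : B → ℤ} (i : B) (hi : 0 < α i) (h : IsDescent M σ x₀ ω k x α) :
      IsDescent M σ x₀ ω (k + 1) (σ i x) (M.reflect i α)

variable {σ : B → X → X} {x₀ : X} {ω : B → ℤ}

theorem IsDescent.ascend_and_fix (hM : M.IsSimplyLaced) (hσ : M.IsSimpleAction σ)
    (hω : ∀ i, 0 ≤ ω i) (hx₀ : ∀ i, ω i = 0 → σ i x₀ = x₀) (k : ℕ) :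
    ∀ x α, M.IsDescent σ x₀ ω k x α → ∀ i,
      (α i < 0 → ∃ l y, l + 1 = k ∧ M.IsDescent σ x₀ ω l y (M.reflect i α) ∧ x = σ i y) ∧
      (α i = 0 → σ i x = x) := by
  induction k using Nat.strong_induction_on with
  | _ k ih =>
    intro x α hD i
    cases hD with
    | refl => exact ⟨fun h ↦ absurd h (hω i).not_gt, hx₀ i⟩
    | @step k y β t ht hD =>
      have htt : M.reflect t β t = -β t := by simp only [reflect, cartan_self]; ring
      rcases hM t i with h | h | h
      · obtain rfl := M.eq_of_apply_eq_one h
        exact ⟨fun _ ↦ ⟨k, y, rfl, by rwa [reflect_reflect], rfl⟩, fun h0 ↦ by omega⟩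
      · have hti : M.reflect t β i = β i := by simp [reflect, cartan_eq_zero h]
        rw [hti]
        constructor
        · intro hi
          obtain ⟨l, z, rfl, hz, rfl⟩ := (ih k (by omega) y β hD i).1 hi
          refine ⟨l + 1, σ t z, rfl, ?_, hσ.comm _ _ _ h⟩
          rw [← reflect_comm h]
          refine hz.step t ?_
          have : M.reflect i β t = β t := by
            simp [reflect, M.cartan_comm i t, cartan_eq_zero h]
          omega
        · intro hi
          rw [← hσ.comm _ _ _ h, (ih k (by omega) y β hD i).2 hi]
      · have hti : M.reflect t β i = β i + β t := by simp [reflect, cartan_eq_neg_one h]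
        have hit : M.reflect i β t = β t + β i := by
          simp [reflect, M.cartan_comm i t, cartan_eq_neg_one h]
        rw [hti]
        constructor
        · intro hi
          obtain ⟨l, z, rfl, hz, rfl⟩ := (ih k (by omega) y β hD i).1 (by omega)
          obtain ⟨m, u, rfl, hu, rfl⟩ := (ih l (by omega) z _ hz t).1 (by omega)
          refine ⟨m + 2, σ t (σ i u), rfl, ?_, hσ.braid _ _ _ h⟩
          have hγi : M.reflect t (M.reflect i β) i = β t := by
            simp only [reflect, cartan_self, M.cartan_comm i t, cartan_eq_neg_one h]
            ring
          have hγt : M.reflect i (M.reflect t (M.reflect i β)) t = -β i := by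
            simp only [reflect, cartan_self, M.cartan_comm i t, cartan_eq_neg_one h]
            ring
          convert (hu.step i (by omega)).step t (by omega) using 1
          rw [← reflect_braid h, reflect_reflect]
        · intro hi
          obtain ⟨l, z, rfl, hz, rfl⟩ := (ih k (by omega) y β hD i).1 (by omega)
          have hfix := (ih l (by omega) z _ hz t).2 (by omega)
          rw [← hσ.braid _ _ _ h, hfix]


theorem IsDescent.length_unique (hM : M.IsSimplyLaced) (hω : ∀ i, 0 ≤ ω i) {k l : ℕ} {α : B → ℤ}
    {x y : Unit} (hk : M.IsDescent (fun _ ↦ id) () ω k x α)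
    (hl : M.IsDescent (fun _ ↦ id) () ω l y α) : k = l := by
  have key := IsDescent.ascend_and_fix (x₀ := ()) (σ := fun _ ↦ id) hM
    ⟨fun _ _ _ _ ↦ rfl, fun _ _ _ _ ↦ rfl⟩ hω (fun _ _ ↦ rfl)
  induction hk generalizing l with
  | refl =>
    cases hl with
    | refl => rfl
    | @step l y β i hi h =>
      have := hω i
      simp only [reflect, cartan_self] at this
      omega
  | @step k x β i hi h ih =>
    have hneg : M.reflect i β i < 0 := by simp only [reflect, cartan_self]; omega
    obtain ⟨m, z, rfl, hz, -⟩ := (key l y _ hl i).1 hneg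
    rw [reflect_reflect] at hz
    rw [ih hz]

theorem IsDescent.forget {k : ℕ} {x : X} {α : B → ℤ} (h : M.IsDescent σ x₀ ω k x α) :
    M.IsDescent (fun _ ↦ id) () ω k () α := by
  induction h with
  | refl => exact .refl
  | step i hi _ ih => exact ih.step i hi

/-- The reflection of weights as a permutation. -/
def reflectPerm (M : CoxeterMatrix B) (i : B) : Equiv.Perm (B → ℤ) :=
  Function.Involutive.toPerm (M.reflect i) (reflect_reflect i)

theorem isLiftable_of_isSimplyLaced (hM : M.IsSimplyLaced) {G : Type*} [Group G] {f : B → G}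
    (hsq : ∀ i, f i * f i = 1) (hcomm : ∀ i j, M i j = 2 → f i * f j = f j * f i)
    (hbraid : ∀ i j, M i j = 3 → f i * f j * f i = f j * f i * f j) : M.IsLiftable f := by
  intro i j
  rcases hM i j with h | h | h
  · rw [h, M.eq_of_apply_eq_one h, hsq, one_pow]
  · rw [h, pow_two]
    nth_rewrite 2 [hcomm i j h]
    rw [mul_assoc, ← mul_assoc (f j), hsq, one_mul, hsq]
  · have h3 : (f i * f j) ^ 3 = (f i * f j * f i) * (f j * f i * f j) := by
      simp only [pow_succ, pow_zero, one_mul, mul_assoc]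
    rw [h, h3, ← hbraid i j h]
    simp only [mul_assoc]
    rw [← mul_assoc (f i) (f i), hsq, one_mul, ← mul_assoc (f j) (f j), hsq, one_mul, hsq]

/-- The action of a simply laced Coxeter group on its weights. -/
noncomputable def weightHom (hM : M.IsSimplyLaced) : M.Group →* Equiv.Perm (B → ℤ) :=
  M.toCoxeterSystem.lift ⟨M.reflectPerm, isLiftable_of_isSimplyLaced hM
    (fun i ↦ Equiv.ext (reflect_reflect i)) (fun _ _ h ↦ Equiv.ext (reflect_comm h))
    (fun _ _ h ↦ Equiv.ext (reflect_braid h))⟩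

theorem weightHom_simple (hM : M.IsSimplyLaced) (i : B) (α : B → ℤ) :
    weightHom hM (M.simple i) α = M.reflect i α := by
  rw [weightHom, ← toCoxeterSystem_simple, CoxeterSystem.lift_apply_simple]
  rfl

theorem simple_mul_self (i : B) : M.simple i * M.simple i = 1 := by
  simpa using M.toCoxeterSystem.simple_mul_simple_self i

theorem inv_simple (i : B) : (M.simple i)⁻¹ = M.simple i :=
  inv_eq_of_mul_eq_one_left (simple_mul_self i)

theorem simple_mul_comm {i j : B} (h : M i j = 2) :
    M.simple i * M.simple j = M.simple j * M.simple i := by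
  have := M.toCoxeterSystem.simple_mul_simple_pow i j
  rw [h, pow_two, mul_eq_one_iff_eq_inv, mul_inv_rev] at this
  simpa [inv_simple] using this

theorem simple_braid {i j : B} (h : M i j = 3) :
    M.simple i * M.simple j * M.simple i = M.simple j * M.simple i * M.simple j := by
  have := M.toCoxeterSystem.simple_mul_simple_pow i j
  have h3 : ∀ a b : M.Group, (a * b) ^ 3 = (a * b * a) * (b * a * b) := by
    intro a b
    simp only [pow_succ, pow_zero, one_mul, mul_assoc]
  rw [h, h3, mul_eq_one_iff_eq_inv, mul_inv_rev, mul_inv_rev] at this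
  simpa [mul_assoc, inv_simple] using this

theorem isSimpleAction_smul [MulAction M.Group X] :
    M.IsSimpleAction fun i (x : X) ↦ M.simple i • x where
  comm i j x h := by simp [smul_smul, simple_mul_comm h]
  braid i j x h := by simp only [smul_smul, simple_braid h, ← mul_assoc]

theorem exists_isDescent_smul (hM : M.IsSimplyLaced) [MulAction M.Group X]
    (hω : ∀ i, 0 ≤ ω i) (hx₀ : ∀ i, ω i = 0 → M.simple i • x₀ = x₀) (w : M.Group) :
    ∃ k, M.IsDescent (fun i (x : X) ↦ M.simple i • x) x₀ ω k (w • x₀) (weightHom hM w ω) := by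
  have key := IsDescent.ascend_and_fix hM (isSimpleAction_smul (X := X)) hω hx₀
  induction w using M.toCoxeterSystem.simple_induction_left with
  | one => exact ⟨0, by simpa using .refl⟩
  | mul_simple_left w i ih =>
    obtain ⟨k, hk⟩ := ih
    rw [toCoxeterSystem_simple, map_mul, Equiv.Perm.mul_apply, weightHom_simple, mul_smul]
    rcases lt_trichotomy (weightHom hM w ω i) 0 with h | h | h
    · obtain ⟨l, y, rfl, hy, hwy⟩ := (key k _ _ hk i).1 h
      refine ⟨l, ?_⟩
      rw [hwy]
      simpa [smul_smul, simple_mul_self] using hy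
    · refine ⟨k, ?_⟩
      rw [(key k _ _ hk i).2 h]
      have : M.reflect i (weightHom hM w ω) = weightHom hM w ω := by
        funext j
        simp [reflect, h]
      rwa [this]
    · exact ⟨k + 1, hk.step i h⟩

/-- The stabilizer of a dominant weight fixes every point fixed by the simple reflections
that fix the weight. -/
theorem smul_eq_of_weightHom_eq (hM : M.IsSimplyLaced) [MulAction M.Group X]
    (hω : ∀ i, 0 ≤ ω i) (hx₀ : ∀ i, ω i = 0 → M.simple i • x₀ = x₀) {w : M.Group}
    (hw : weightHom hM w ω = ω) : w • x₀ = x₀ := by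
  obtain ⟨k, hk⟩ := exists_isDescent_smul hM hω hx₀ w
  rw [hw] at hk
  obtain rfl := hk.forget.length_unique hM hω .refl
  generalize w • x₀ = y at hk
  cases hk
  rfl

theorem IsDescent.exists_weightHom (hM : M.IsSimplyLaced) {k : ℕ} {x : X} {α : B → ℤ}
    (h : M.IsDescent σ x₀ ω k x α) : ∃ w, weightHom hM w ω = α := by
  induction h with
  | refl => exact ⟨1, by simp⟩
  | step i _ _ ih =>
    obtain ⟨w, rfl⟩ := ih
    exact ⟨M.simple i * w, by rw [map_mul, Equiv.Perm.mul_apply, weightHom_simple]⟩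

theorem range_weightHom (hM : M.IsSimplyLaced) (hω : ∀ i, 0 ≤ ω i) :
    Set.range (fun w ↦ weightHom hM w ω) =
      {α | ∃ k, M.IsDescent (fun _ ↦ id) () ω k () α} := by
  ext α
  constructor
  · rintro ⟨w, rfl⟩
    let _ : MulAction M.Group Unit :=
      { smul := fun _ x ↦ x, one_smul := fun _ ↦ rfl, mul_smul := fun _ _ _ ↦ rfl }
    obtain ⟨k, hk⟩ := exists_isDescent_smul (x₀ := ()) hM hω (fun _ _ ↦ rfl) w
    exact ⟨k, hk.forget⟩
  · rintro ⟨k, hk⟩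
    exact hk.exists_weightHom hM

theorem index_eq_ncard (hM : M.IsSimplyLaced) (hω : ∀ i, 0 ≤ ω i) {H : Subgroup M.Group}
    (hH : ∀ i, ω i = 0 → M.simple i ∈ H) (hfix : ∀ w ∈ H, weightHom hM w ω = ω) :
    H.index = {α | ∃ k, M.IsDescent (fun _ ↦ id) () ω k () α}.ncard := by
  let _ : MulAction M.Group (B → ℤ) := MulAction.compHom _ (weightHom hM)
  have hstab : H = MulAction.stabilizer M.Group ω := by
    ext w
    refine ⟨hfix w, fun hw ↦ ?_⟩
    have : w • ((1 : M.Group) : M.Group ⧸ H) = ((1 : M.Group) : M.Group ⧸ H) := by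
      refine smul_eq_of_weightHom_eq hM hω (fun i hi ↦ ?_) hw
      rw [MulAction.Quotient.smul_coe, smul_eq_mul, mul_one, QuotientGroup.eq]
      simpa using hH i hi
    rw [MulAction.Quotient.smul_coe, smul_eq_mul, mul_one, QuotientGroup.eq] at this
    simpa using this
  rw [hstab, MulAction.index_stabilizer, ← range_weightHom hM hω]
  rfl

end Weights

section Counting

variable {n : ℕ}

/-- `CoxeterMatrix.reflect` on weights given by the list of their coordinates. -/
def reflectList (M : CoxeterMatrix (Fin n)) (i : Fin n) (l : List ℤ) : List ℤ :=
  (List.finRange n).map fun j ↦ l.getD j.1 0 - l.getD i.1 0 * M.cartan i j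

/-- The weights obtained from those in `L` by one lowering reflection. -/
def descents (M : CoxeterMatrix (Fin n)) (L : List (List ℤ)) : List (List ℤ) :=
  (L.flatMap fun l ↦ ((List.finRange n).filter fun i ↦ 0 < l.getD i.1 0).map
    (M.reflectList · l)).dedup

/-- The number of weights obtained from those in `L` by fewer than `k` lowering reflections,
provided that no such weight can be lowered further. -/
def countDescents (M : CoxeterMatrix (Fin n)) : ℕ → List (List ℤ) → Option ℕ
  | _, [] => some 0
  | 0, _ :: _ => none
  | k + 1, l :: L => (countDescents M k (descents M (l :: L))).map (· + (l :: L).length)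

/-- The weight with a given list of coordinates. -/
def ofList (l : List ℤ) : Fin n → ℤ := fun j ↦ l.getD j.1 0

variable {M : CoxeterMatrix (Fin n)}

theorem ofList_reflectList (i : Fin n) (l : List ℤ) :
    ofList (M.reflectList i l) = M.reflect i (ofList l) := by
  funext j
  simp [ofList, reflectList, reflect]

theorem ofList_injOn : Set.InjOn (ofList (n := n)) {l | l.length = n} := by
  intro l hl l' hl' h
  simp only [Set.mem_ofPred_eq] at hl hl'
  refine List.ext_getElem (hl.trans hl'.symm) fun i hi hi' ↦ ?_
  simpa [ofList, hi, hi'] using congrFun h ⟨i, by omega⟩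

variable {ω : Fin n → ℤ}

/-- `L` lists without repetition the weights obtained from `ω` by `k` lowering reflections. -/
structure IsLevel (M : CoxeterMatrix (Fin n)) (ω : Fin n → ℤ) (k : ℕ) (L : List (List ℤ)) :
    Prop where
  nodup : L.Nodup
  length_eq : ∀ l ∈ L, l.length = n
  mem_iff : ∀ α, (∃ l ∈ L, ofList l = α) ↔ M.IsDescent (fun _ ↦ id) () ω k () α

theorem IsLevel.descents {k : ℕ} {L : List (List ℤ)} (h : M.IsLevel ω k L) :
    M.IsLevel ω (k + 1) (M.descents L) where
  nodup := List.nodup_dedup _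
  length_eq l hl := by
    simp only [CoxeterMatrix.descents, List.mem_dedup, List.mem_flatMap, List.mem_map] at hl
    obtain ⟨_, _, _, _, rfl⟩ := hl
    simp [reflectList]
  mem_iff α := by
    simp only [CoxeterMatrix.descents, List.mem_dedup, List.mem_flatMap, List.mem_map,
      List.mem_filter, List.mem_finRange, true_and, decide_eq_true_eq]
    constructor
    · rintro ⟨_, ⟨l, hl, i, hi, rfl⟩, rfl⟩
      rw [ofList_reflectList]
      exact ((h.mem_iff _).1 ⟨l, hl, rfl⟩).step i hi
    · intro hα
      cases hα with
      | step i hi hβ =>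
        obtain ⟨l, hl, rfl⟩ := (h.mem_iff _).2 hβ
        exact ⟨_, ⟨l, hl, i, hi, rfl⟩, ofList_reflectList i l⟩

theorem IsLevel.ncard {k : ℕ} {L : List (List ℤ)} (h : M.IsLevel ω k L) :
    {α | M.IsDescent (fun _ ↦ id) () ω k () α}.Finite ∧
      {α | M.IsDescent (fun _ ↦ id) () ω k () α}.ncard = L.length := by
  have hS : {α | M.IsDescent (fun _ ↦ id) () ω k () α} = ofList '' (L.toFinset : Set (List ℤ)) := by
    ext α
    simp [← h.mem_iff]
  rw [hS]
  refine ⟨L.toFinset.finite_toSet.image _, ?_⟩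
  rw [Set.InjOn.ncard_image, Set.ncard_coe_finset, List.toFinset_card_of_nodup h.nodup]
  exact ofList_injOn.mono fun l hl ↦ h.length_eq l (by simpa using hl)

theorem IsLevel.eq_empty_of_nil {k : ℕ} (h : M.IsLevel ω k []) :
    {α | ∃ j, k ≤ j ∧ M.IsDescent (fun _ ↦ id) () ω j () α} = ∅ := by
  have key : ∀ j α, ¬ M.IsDescent (fun _ ↦ id) () ω (k + j) () α := by
    intro j
    induction j with
    | zero => exact fun α hα ↦ by simpa using (h.mem_iff α).2 hα
    | succ j ih =>
      intro α hα
      cases hα with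
      | step i hi hβ => exact ih _ hβ
  rw [Set.eq_empty_iff_forall_notMem]
  rintro α ⟨j, hj, hα⟩
  obtain ⟨d, rfl⟩ := Nat.exists_eq_add_of_le hj
  exact key d α hα

theorem IsLevel.ncard_of_countDescents (hM : M.IsSimplyLaced) (hω : ∀ i, 0 ≤ ω i) (m : ℕ)
    {k : ℕ} {L : List (List ℤ)} (h : M.IsLevel ω k L) {N : ℕ}
    (hN : M.countDescents m L = some N) :
    {α | ∃ j, k ≤ j ∧ M.IsDescent (fun _ ↦ id) () ω j () α}.Finite ∧
      {α | ∃ j, k ≤ j ∧ M.IsDescent (fun _ ↦ id) () ω j () α}.ncard = N := by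
  induction m generalizing k L N with
  | zero =>
    match L with
    | [] =>
      obtain rfl : 0 = N := by simpa [countDescents] using hN
      simp [h.eq_empty_of_nil]
    | _ :: _ => simp [countDescents] at hN
  | succ m ih =>
    match L with
    | [] =>
      obtain rfl : 0 = N := by simpa [countDescents] using hN
      simp [h.eq_empty_of_nil]
    | l :: L =>
      simp only [countDescents, Option.map_eq_some_iff] at hN
      obtain ⟨N, hN, rfl⟩ := hN
      obtain ⟨hfin, hcard⟩ := ih h.descents hN
      obtain ⟨hfin', hcard'⟩ := h.ncard
      have hunion : {α | ∃ j, k ≤ j ∧ M.IsDescent (fun _ ↦ id) () ω j () α} =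
          {α | ∃ j, k + 1 ≤ j ∧ M.IsDescent (fun _ ↦ id) () ω j () α} ∪
            {α | M.IsDescent (fun _ ↦ id) () ω k () α} := by
        ext α
        constructor
        · rintro ⟨j, hj, hα⟩
          rcases hj.eq_or_lt with rfl | hj
          · exact Or.inr hα
          · exact Or.inl ⟨j, hj, hα⟩
        · rintro (⟨j, hj, hα⟩ | hα)
          · exact ⟨j, by omega, hα⟩
          · exact ⟨k, le_rfl, hα⟩
      have hdisj : Disjoint {α | ∃ j, k + 1 ≤ j ∧ M.IsDescent (fun _ ↦ id) () ω j () α}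
          {α | M.IsDescent (fun _ ↦ id) () ω k () α} := by
        rw [Set.disjoint_left]
        rintro α ⟨j, hj, hα⟩ hα'
        have := hα.length_unique hM hω hα'
        omega
      rw [hunion, Set.ncard_union_eq hdisj hfin hfin', hcard, hcard']
      exact ⟨hfin.union hfin', rfl⟩

theorem ncard_of_countDescents (hM : M.IsSimplyLaced) {m N : ℕ} {l : List ℤ} (hl : l.length = n)
    (hpos : ∀ a ∈ l, 0 ≤ a) (hN : M.countDescents m [l] = some N) :
    {α | ∃ k, M.IsDescent (fun _ ↦ id) () (ofList l) k () α}.ncard = N := by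
  have hω : ∀ i, 0 ≤ ofList (n := n) l i := fun i ↦ by
    have hi : i.1 < l.length := by omega
    simpa [ofList, hi] using hpos _ (List.getElem_mem hi)
  have h0 : M.IsLevel (ofList l) 0 [l] := by
    refine ⟨by simp, by simpa, fun α ↦ ?_⟩
    simp only [List.mem_singleton, exists_eq_left]
    refine ⟨by rintro rfl; exact .refl, fun h ↦ ?_⟩
    cases h
    rfl
  simpa using (h0.ncard_of_countDescents hM hω m hN).2

end Counting

section Exceptional

/-- The matrix of the first `n` nodes of the diagram of type `E₈`. -/
def truncE (n : ℕ) (h : n ≤ 8) : CoxeterMatrix (Fin n) where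
  M := Matrix.of fun i j ↦ E₈ (i.castLE h) (j.castLE h)
  isSymm := by
    ext i j
    rw [Matrix.transpose_apply, Matrix.of_apply, Matrix.of_apply, E₈.symmetric]
  diagonal i := by rw [Matrix.of_apply, E₈.diagonal]
  off_diagonal i j hij := by
    rw [Matrix.of_apply]
    exact E₈.off_diagonal _ _ ((Fin.castLE_injective h).ne hij)

theorem truncE_six : truncE 6 (by decide) = E₆ := by
  ext i j; fin_cases i <;> fin_cases j <;> rfl

theorem truncE_seven : truncE 7 (by decide) = E₇ := by
  ext i j; fin_cases i <;> fin_cases j <;> rfl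

theorem truncE_eight : truncE 8 (by decide) = E₈ := rfl

theorem isSimplyLaced_E₈ : E₈.IsSimplyLaced := by
  intro i j
  fin_cases i <;> fin_cases j <;>
    first | exact .inl rfl | exact .inr (.inl rfl) | exact .inr (.inr rfl)

theorem isSimplyLaced_truncE {n : ℕ} (h : n ≤ 8) : (truncE n h).IsSimplyLaced :=
  fun i j ↦ isSimplyLaced_E₈ (i.castLE h) (j.castLE h)

/-- The inclusion of the group generated by all the simple reflections but the last. -/
noncomputable def truncEHom {n : ℕ} (h : n + 1 ≤ 8) :
    (truncE n (by omega)).Group →* (truncE (n + 1) h).Group :=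
  (truncE n (by omega)).toCoxeterSystem.lift ⟨fun i ↦ (truncE (n + 1) h).simple i.castSucc,
    fun i j ↦ (truncE (n + 1) h).toCoxeterSystem.simple_mul_simple_pow i.castSucc j.castSucc⟩

theorem truncEHom_simple {n : ℕ} (h : n + 1 ≤ 8) (i : Fin n) :
    truncEHom h ((truncE n (by omega)).simple i) = (truncE (n + 1) h).simple i.castSucc := by
  rw [← toCoxeterSystem_simple (truncE n _)]
  exact CoxeterSystem.lift_apply_simple _ _ i

theorem card_truncE_succ_dvd {n : ℕ} (h : n + 1 ≤ 8) {m N : ℕ}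
    (hN : (truncE (n + 1) h).countDescents m [List.replicate n 0 ++ [1]] = some N) :
    Nat.card (truncE (n + 1) h).Group ∣ N * Nat.card (truncE n (by omega)).Group := by
  have hM := isSimplyLaced_truncE h
  have hpos : ∀ a ∈ List.replicate n 0 ++ [1], (0 : ℤ) ≤ a := by
    simp +contextual [List.mem_replicate, or_imp]
  have hcast : ∀ i : Fin n, ofList (List.replicate n 0 ++ [1]) i.castSucc = 0 := fun i ↦ by
    simp [ofList, List.getD_eq_getElem?_getD]
  have hlast : ofList (List.replicate n 0 ++ [1]) (Fin.last n) = 1 := by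
    simp [ofList]
  have hindex : (truncEHom h).range.index = N := by
    rw [← ncard_of_countDescents hM (by simp) hpos hN]
    refine index_eq_ncard hM (fun i ↦ ?_) (fun i hi ↦ ?_) ?_
    · refine Fin.lastCases ?_ (fun i ↦ ?_) i
      · rw [hlast]; exact zero_le_one
      · rw [hcast]
    · induction i using Fin.lastCases with
      | last => rw [hlast] at hi; exact absurd hi one_ne_zero
      | cast i => exact ⟨_, truncEHom_simple h i⟩
    · rintro _ ⟨v, rfl⟩
      induction v using (truncE n (by omega)).toCoxeterSystem.simple_induction_left with
      | one => simp
      | mul_simple_left v i ih =>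
        rw [toCoxeterSystem_simple, map_mul, map_mul, Equiv.Perm.mul_apply, ih, truncEHom_simple,
          weightHom_simple]
        funext j
        simp only [reflect, hcast, zero_mul, sub_zero]
  rw [← (truncEHom h).range.index_mul_card, hindex]
  exact Nat.mul_dvd_mul_left _ (Subgroup.card_range_dvd _)

theorem card_truncE_zero : Nat.card (truncE 0 (by decide)).Group = 1 := by
  have h := (truncE 0 (by decide)).toCoxeterSystem.subgroup_closure_range_simple
  rw [Set.range_eq_empty, Subgroup.closure_empty] at h
  rw [← Subgroup.card_top, ← h, Subgroup.card_bot]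

theorem card_truncE_six_dvd : Nat.card (truncE 6 (by decide)).Group ∣ 51840 := by
  have h1 := card_truncE_succ_dvd (n := 0) (by decide) (m := 2) (N := 2) (by decide +kernel)
  have h2 := card_truncE_succ_dvd (n := 1) (by decide) (m := 2) (N := 2) (by decide +kernel)
  have h3 := card_truncE_succ_dvd (n := 2) (by decide) (m := 3) (N := 3) (by decide +kernel)
  have h4 := card_truncE_succ_dvd (n := 3) (by decide) (m := 7) (N := 10) (by decide +kernel)
  have h5 := card_truncE_succ_dvd (n := 4) (by decide) (m := 11) (N := 16) (by decide +kernel)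
  have h6 := card_truncE_succ_dvd (n := 5) (by decide) (m := 17) (N := 27) (by decide +kernel)
  rw [card_truncE_zero] at h1
  exact h6.trans (Nat.mul_dvd_mul_left 27 (h5.trans (Nat.mul_dvd_mul_left 16
    (h4.trans (Nat.mul_dvd_mul_left 10 (h3.trans (Nat.mul_dvd_mul_left 3
      (h2.trans (Nat.mul_dvd_mul_left 2 h1)))))))))

theorem card_truncE_seven_dvd : Nat.card (truncE 7 (by decide)).Group ∣ 2903040 :=
  (card_truncE_succ_dvd (n := 6) (by decide) (m := 28) (N := 56) (by decide +kernel)).trans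
    (Nat.mul_dvd_mul_left 56 card_truncE_six_dvd)

theorem card_truncE_eight_dvd : Nat.card (truncE 8 (by decide)).Group ∣ 696729600 :=
  (card_truncE_succ_dvd (n := 7) (by decide) (m := 58) (N := 240) (by decide +kernel)).trans
    (Nat.mul_dvd_mul_left 240 card_truncE_seven_dvd)

end Exceptional

section Generation

variable {G : Type*} [Group G]

theorem prod_range_mul {m : ℕ} {t : ℕ → G}
    (hcomm : ∀ i j, i + 1 < j → j < m → t i * t j = t j * t i)
    (hbraid : ∀ i, i + 1 < m → t i * t (i + 1) * t i = t (i + 1) * t i * t (i + 1)) :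
    ∀ k < m, ∀ i < k, ((List.range (k + 1)).map t).prod * t i =
      t (i + 1) * ((List.range (k + 1)).map t).prod := by
  intro k
  induction k with
  | zero => omega
  | succ k ih =>
    intro hk i hi
    rcases (Nat.lt_succ_iff.1 hi).lt_or_eq with hi | rfl
    · rw [List.range_succ, List.map_append, List.prod_append, List.map_singleton,
        List.prod_singleton, mul_assoc, ← hcomm i (k + 1) (by omega) hk, ← mul_assoc,
        ih (by omega) i hi, mul_assoc]
    · have hc : ∀ l ≤ i, ((List.range l).map t).prod * t (i + 1) =
          t (i + 1) * ((List.range l).map t).prod := by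
        intro l hl
        induction l with
        | zero => simp
        | succ l ihl =>
          rw [List.range_succ, List.map_append, List.prod_append, List.map_singleton,
            List.prod_singleton, mul_assoc, hcomm l (i + 1) (by omega) hk, ← mul_assoc,
            ihl (by omega), mul_assoc]
      simp only [List.range_succ (n := i + 1), List.range_succ (n := i), List.map_append,
        List.prod_append, List.map_singleton, List.prod_singleton]
      rw [mul_assoc, mul_assoc, ← mul_assoc (t i), hbraid i hk, ← mul_assoc, ← mul_assoc,
        hc i le_rfl]
      simp only [mul_assoc]

/-- The Coxeter element of a chain of `k` simple reflections has order dividing `k + 1`. -/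
theorem prod_range_pow {m : ℕ} {t : ℕ → G} (hsq : ∀ i < m, t i * t i = 1)
    (hcomm : ∀ i j, i + 1 < j → j < m → t i * t j = t j * t i)
    (hbraid : ∀ i, i + 1 < m → t i * t (i + 1) * t i = t (i + 1) * t i * t (i + 1)) :
    ∀ k ≤ m, ((List.range k).map t).prod ^ (k + 1) = 1 := by
  have hP : ∀ k, ((List.range (k + 1)).map t).prod = ((List.range k).map t).prod * t k := by
    simp [List.range_succ]
  intro k
  induction k with
  | zero => simp
  | succ k ih =>
    intro hk
    have hshift := prod_range_mul hcomm hbraid k hk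
    set c := ((List.range (k + 1)).map t).prod with hc
    have hct : c * t k = ((List.range k).map t).prod := by
      rw [hc, hP, mul_assoc, hsq k hk, mul_one]
    have hpow : ∀ j ≤ k, ∀ i, i + j = k → t k * c ^ j = c ^ j * t i := by
      intro j
      induction j with
      | zero => rintro - i rfl; simp
      | succ j ihj =>
        intro hj i hi
        rw [pow_succ, ← mul_assoc, ihj (by omega) (i + 1) (by omega), mul_assoc,
          ← hshift i (by omega), mul_assoc]
    have key : ∀ j ≤ k + 1, ∀ i, i + j = k + 1 →
        (c * t k) ^ j = c ^ j * (((List.range i).map t).prod⁻¹ * c) := by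
      intro j
      induction j with
      | zero => rintro - i rfl; simp [hc]
      | succ j ihj =>
        intro hj i hi
        rw [pow_succ', ihj (by omega) (i + 1) (by omega), mul_assoc c, ← mul_assoc (t k),
          hpow j (by omega) i (by omega), hP, mul_inv_rev,
          inv_eq_of_mul_eq_one_left (hsq i (by omega)), pow_succ']
        simp only [mul_assoc]
        rw [← mul_assoc (t i) (t i), hsq i (by omega), one_mul]
    have := key (k + 1) le_rfl 0 (by omega)
    rw [hct, ih (by omega)] at this
    rw [pow_succ, this]
    simp

theorem eq_of_braid_of_commute {a b c : G} (hb : b * b = 1) (hab : a = b)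
    (hac : a * c = c * a) (hbraid : b * c * b = c * b * c) : b = c := by
  subst hab
  rw [hac, mul_assoc, hb, mul_one, mul_assoc, left_eq_mul] at hbraid
  exact mul_right_cancel (b := a) (by rw [hb, ← hac, hbraid])

theorem normal_closure_orderOf (p : ℕ) :
    (Subgroup.closure {w : G | ∃ k : ℕ, orderOf w = p ^ k}).Normal := by
  refine ⟨fun w hw g ↦ ?_⟩
  induction hw using Subgroup.closure_induction with
  | mem x hx =>
    obtain ⟨k, hk⟩ := hx
    exact Subgroup.subset_closure ⟨k, by
      rw [← hk, ← MulAut.conj_apply, MulEquiv.orderOf_eq]⟩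
  | one => simp
  | mul x y _ _ hx hy => simpa [mul_assoc] using mul_mem hx hy
  | inv x _ hx => simpa [mul_assoc] using inv_mem hx

theorem mem_closure_orderOf {p : ℕ} (hp : p.Prime) {w : G} (hw : w ^ p = 1) :
    w ∈ Subgroup.closure {w : G | ∃ k : ℕ, orderOf w = p ^ k} := by
  rcases (Nat.dvd_prime hp).1 (orderOf_dvd_of_pow_eq_one hw) with h | h
  · exact Subgroup.subset_closure ⟨0, by rw [h, pow_zero]⟩
  · exact Subgroup.subset_closure ⟨1, by rw [h, pow_one]⟩

end Generation

section Index

variable {n : ℕ}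

/-- The simple reflections of a truncation of `E₈`, indexed by all natural numbers. -/
noncomputable def simpleE (h : n ≤ 8) (k : ℕ) : (truncE n h).Group :=
  if hk : k < n then (truncE n h).simple ⟨k, hk⟩ else 1

theorem simpleE_sq (h : n ≤ 8) (k : ℕ) : simpleE h k * simpleE h k = 1 := by
  unfold simpleE
  split_ifs
  · exact simple_mul_self _
  · exact mul_one 1

theorem simpleE_comm (h : n ≤ 8) (i j : Fin 8) (hij : E₈ i j = 2) :
    simpleE h i * simpleE h j = simpleE h j * simpleE h i := by
  unfold simpleE
  split_ifs
  · exact simple_mul_comm hij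
  all_goals simp

theorem simpleE_braid (h : n ≤ 8) (i j : Fin 8) (hij : E₈ i j = 3) (hi : i < n) (hj : j < n) :
    simpleE h i * simpleE h j * simpleE h i = simpleE h j * simpleE h i * simpleE h j := by
  simp only [simpleE, hi, hj, dif_pos]
  exact simple_braid hij

/-- The nodes of the longest chain in the diagram of type `E₈`, from the end of the arm of
length two. -/
def chainE (k : ℕ) : ℕ := if k = 0 then 0 else k + 1

theorem simpleE_chainE_comm (h : n ≤ 8) {m : ℕ} (hm : m < n) (i j : ℕ) (hij : i + 1 < j)
    (hj : j < m) : simpleE h (chainE i) * simpleE h (chainE j) =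
      simpleE h (chainE j) * simpleE h (chainE i) := by
  have hj' : j < 7 := by omega
  have hi' : i < 5 := by omega
  have h1 : chainE i < 8 := by unfold chainE; split_ifs <;> omega
  have h2 : chainE j < 8 := by unfold chainE; split_ifs <;> omega
  refine simpleE_comm h ⟨chainE i, h1⟩ ⟨chainE j, h2⟩ ?_
  clear hm hj
  interval_cases i <;> interval_cases j <;> first | omega | rfl

theorem simpleE_chainE_braid (h : n ≤ 8) {m : ℕ} (hm : m < n) (i : ℕ) (hi : i + 1 < m) :
    simpleE h (chainE i) * simpleE h (chainE (i + 1)) * simpleE h (chainE i) =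
      simpleE h (chainE (i + 1)) * simpleE h (chainE i) * simpleE h (chainE (i + 1)) := by
  have hi' : i < 6 := by omega
  have h1 : chainE i < n := by unfold chainE; split_ifs <;> omega
  have h2 : chainE (i + 1) < n := by unfold chainE; split_ifs <;> omega
  refine simpleE_braid h ⟨chainE i, by omega⟩ ⟨chainE (i + 1), by omega⟩ ?_ h1 h2
  interval_cases i <;> rfl

theorem map_simpleE_eq {Q : Type*} [Group Q] (h : n ≤ 8) (h6 : 6 ≤ n)
    (π : (truncE n h).Group →* Q) (h02 : π (simpleE h 0) = π (simpleE h 2)) (k : ℕ) (hk : k < n) :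
    π (simpleE h k) = π (simpleE h 2) := by
  have step : ∀ a b c : Fin 8, π (simpleE h a) = π (simpleE h b) → c < n → b < n →
      E₈ a c = 2 → E₈ b c = 3 → π (simpleE h c) = π (simpleE h b) := by
    intro a b c hab hc hb hac hbc
    refine (eq_of_braid_of_commute ?_ hab ?_ ?_).symm
    · rw [← map_mul, simpleE_sq, map_one]
    · rw [← map_mul, simpleE_comm h a c hac, map_mul]
    · simp only [← map_mul, simpleE_braid h b c hbc hb hc]
  have h3 := step 0 2 3 h02 (by simp; omega) (by simp; omega) rfl rfl
  have h1 := step 2 3 1 h3.symm (by simp; omega) (by simp; omega) rfl rfl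
  have h4 := step 2 3 4 h3.symm (by simp; omega) (by simp; omega) rfl rfl
  have h5 := step 3 4 5 h4.symm (by simp; omega) (by simp; omega) rfl rfl
  have hk8 : k < 8 := by omega
  have h6 : 6 < n → _ := fun hn ↦ step 4 5 6 h5.symm hn (by simp; omega) rfl rfl
  have h7 : 7 < n → _ := fun hn ↦ step 5 6 7 (h6 (by omega)).symm hn (by simp; omega) rfl rfl
  interval_cases k
  · exact h02
  · exact h1.trans h3
  · rfl
  · exact h3
  · exact h4.trans h3
  · exact h5.trans (h4.trans h3)
  · exact (h6 hk).trans (h5.trans (h4.trans h3))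
  · exact (h7 hk).trans ((h6 (by omega)).trans (h5.trans (h4.trans h3)))

theorem index_closure_orderOf (h : n ≤ 8) (h6 : 6 ≤ n) {p : ℕ} (hp : p.Prime) (hodd : Odd p)
    (hpn : p ≤ n) :
    (Subgroup.closure {w : (truncE n h).Group | ∃ k : ℕ, orderOf w = p ^ k}).index = 2 := by
  set N := Subgroup.closure {w : (truncE n h).Group | ∃ k : ℕ, orderOf w = p ^ k}
  have : N.Normal := normal_closure_orderOf p
  let π := QuotientGroup.mk' N
  obtain ⟨q, rfl⟩ : ∃ q, p = q + 3 := by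
    obtain ⟨r, rfl⟩ := hodd
    have := hp.two_le
    exact ⟨2 * r - 2, by omega⟩
  have hcomm := simpleE_chainE_comm h (m := q + 2) (by omega)
  have hbraid := simpleE_chainE_braid h (m := q + 2) (by omega)
  have h02 : π (simpleE h 0) = π (simpleE h 2) := by
    have hpow := prod_range_pow (fun i _ ↦ simpleE_sq h (chainE i)) hcomm hbraid (q + 2) le_rfl
    have hone : π _ = 1 := (QuotientGroup.eq_one_iff _).2 (mem_closure_orderOf hp hpow)
    have hmul := congrArg π (prod_range_mul hcomm hbraid (q + 1) (by omega) 0 (by omega))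
    rw [map_mul, map_mul, hone, one_mul, mul_one] at hmul
    exact hmul
  have hsimple : ∀ i, π ((truncE n h).simple i) = π (simpleE h 2) := fun i ↦ by
    rw [← map_simpleE_eq h h6 π h02 i i.2, simpleE, dif_pos i.2]
  let cs := (truncE n h).toCoxeterSystem
  have hdich : ∀ w, (cs.lengthParity w = 1 ∧ π w = 1) ∨
      (cs.lengthParity w = Multiplicative.ofAdd 1 ∧ π w = π (simpleE h 2)) := by
    intro w
    induction w using cs.simple_induction_left with
    | one => simp
    | mul_simple_left w i ih =>
      rw [map_mul, map_mul, cs.lengthParity_simple]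
      change (_ ∧ π ((truncE n h).simple i) * _ = _) ∨ (_ ∧ π ((truncE n h).simple i) * _ = _)
      rw [hsimple]
      rcases ih with ⟨h1, h2⟩ | ⟨h1, h2⟩
      · right; simp [h1, h2]
      · left
        rw [h1, h2, ← map_mul π, simpleE_sq, map_one π]
        exact ⟨rfl, rfl⟩
  have hker : N = cs.lengthParity.ker := by
    refine le_antisymm ((Subgroup.closure_le _).2 ?_) fun w hw ↦ ?_
    · rintro w ⟨k, hk⟩
      have h1 : cs.lengthParity w ^ (q + 3) ^ k = 1 := by
        rw [← map_pow, ← hk, pow_orderOf_eq_one, map_one]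
      rcases hdich w with ⟨h2, -⟩ | ⟨h2, -⟩
      · exact h2
      · obtain ⟨r, hr⟩ := hodd.pow (n := k)
        rw [h2, hr, pow_succ, pow_mul] at h1
        rw [show (Multiplicative.ofAdd (1 : ZMod 2)) ^ 2 = 1 from rfl, one_pow, one_mul] at h1
        exact h2.trans h1
    · rcases hdich w with ⟨-, h2⟩ | ⟨h2, -⟩
      · exact (QuotientGroup.eq_one_iff w).1 h2
      · exact absurd (h2.symm.trans hw) (by decide)
  have hsurj : Function.Surjective cs.lengthParity := by
    intro x
    have hx : x = 1 ∨ x = Multiplicative.ofAdd 1 := by revert x; decide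
    rcases hx with rfl | rfl
    · exact ⟨1, map_one _⟩
    · exact ⟨cs.simple ⟨0, by omega⟩, cs.lengthParity_simple _⟩
  rw [hker, Subgroup.index_ker, MonoidHom.range_eq_top.2 hsurj, Subgroup.card_top]
  simp

end Index

end CoxeterMatrix

/-- For each `n ∈ {6, 7, 8}`, let `W` be the Coxeter group of type `Eₙ`
and let `p` be an odd prime dividing `|W|`. Then the subgroup of `W` generated by all
elements of `p`-power order has index `2` in `W`. -/
theorem stmt17 (p : ℕ) (hp : p.Prime) (hodd : Odd p) :
    (p ∣ Nat.card CoxeterMatrix.E₆.Group →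
      (Subgroup.closure {w : CoxeterMatrix.E₆.Group | ∃ k : ℕ, orderOf w = p ^ k}).index = 2) ∧
    (p ∣ Nat.card CoxeterMatrix.E₇.Group →
      (Subgroup.closure {w : CoxeterMatrix.E₇.Group | ∃ k : ℕ, orderOf w = p ^ k}).index = 2) ∧
    (p ∣ Nat.card CoxeterMatrix.E₈.Group →
      (Subgroup.closure {w : CoxeterMatrix.E₈.Group | ∃ k : ℕ, orderOf w = p ^ k}).index = 2) := by
  rw [← CoxeterMatrix.truncE_six, ← CoxeterMatrix.truncE_seven, ← CoxeterMatrix.truncE_eight]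
  have hle : ∀ m N : ℕ, p ∣ N → N ∣ m.factorial ^ 8 → p ≤ m := fun m N h1 h2 ↦
    hp.dvd_factorial.1 (hp.dvd_of_dvd_pow (h1.trans h2))
  refine ⟨fun h ↦ ?_, fun h ↦ ?_, fun h ↦ ?_⟩
  · exact CoxeterMatrix.index_closure_orderOf _ le_rfl hp hodd
      (hle 6 _ (h.trans CoxeterMatrix.card_truncE_six_dvd) (by decide))
  · exact CoxeterMatrix.index_closure_orderOf _ (by norm_num) hp hodd
      (hle 7 _ (h.trans CoxeterMatrix.card_truncE_seven_dvd) (by decide))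
  · exact CoxeterMatrix.index_closure_orderOf _ (by norm_num) hp hodd
      (hle 8 _ (h.trans CoxeterMatrix.card_truncE_eight_dvd) (by decide))
end
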